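/- arXiv:2301.09898 — 7 statements merged into one kernel-verified Lean document; each statement's English description precedes it below -/
import Mathlib

section
/- Fix b > 0 and λ ∈ ℝ. There exist β_c ∈ (0,1] and C > 0 such that for every β ∈ (0, β_c), the partition function Z_{β,b,λ} = ∫_ℝ exp(−b·V_β(η) + λη) dη is finite and satisfies Z_{β,b,λ} ≤ C. -/
open MeasureTheory

/-- A function with `f 0 = f' 0 = 0` and `f'' 0 = 1` dominates `x² / 4` near `0`. -/
theorem exists_quarter_sq_le {f : ℝ → ℝ} (hf : ContDiff ℝ 2 f) (h0 : f 0 = 0)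
    (h1 : deriv f 0 = 0) (h2 : iteratedDeriv 2 f 0 = 1) :
    ∃ δ > 0, ∀ x, |x| ≤ δ → x ^ 2 / 4 ≤ f x := by
  have hd : Differentiable ℝ f := hf.differentiable (by norm_num)
  have hd' : Differentiable ℝ (deriv f) :=
    (contDiff_succ_iff_deriv (n := 1).1 hf).2.2.differentiable (by norm_num)
  have hderiv : deriv (fun x => f x - x ^ 2 / 4) = fun x => deriv f x - x / 2 := by
    ext x
    have h := (hd x).hasDerivAt.sub (((hasDerivAt_id x).pow 2).div_const 4)
    refine (h.congr_deriv ?_).deriv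
    simp
    ring
  have hmin : IsLocalMin (fun x => f x - x ^ 2 / 4) 0 := by
    apply isLocalMin_of_deriv_deriv_pos
    · rw [hderiv]
      have h := (hd' 0).hasDerivAt.sub ((hasDerivAt_id (0 : ℝ)).div_const 2)
      rw [iteratedDeriv_succ, iteratedDeriv_one] at h2
      rw [h2] at h
      have h' : deriv (fun x => deriv f x - x / 2) 0 = 1 - 1 / 2 := h.deriv
      rw [h']
      norm_num
    · rw [hderiv]
      simp [h1]
    · exact (hd.continuous.sub (by fun_prop)).continuousAt
  obtain ⟨ε, hε, h⟩ := Metric.eventually_nhds_iff.1 hmin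
  refine ⟨ε / 2, by positivity, fun x hx => ?_⟩
  have hx' := h (y := x) (by rw [Real.dist_eq, sub_zero]; linarith)
  simp only [h0] at hx'
  linarith

/-- A convex function vanishing at `0` that dominates `x² / 4` on `[-δ, δ]` dominates
`δ |x| / 4` outside. -/
theorem ConvexOn.linear_le_of_quarter_sq_le {f : ℝ → ℝ} (hf : ConvexOn ℝ Set.univ f)
    (h0 : f 0 = 0) {δ : ℝ} (hδ : 0 < δ) (h : ∀ x, |x| ≤ δ → x ^ 2 / 4 ≤ f x)
    {x : ℝ} (hx : δ ≤ |x|) : δ * |x| / 4 ≤ f x := by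
  have hx0 : 0 < |x| := hδ.trans_le hx
  have ht : 0 < δ / |x| := by positivity
  have ht1 : δ / |x| ≤ 1 := (div_le_one hx0).2 hx
  have hc := hf.2 (Set.mem_univ x) (Set.mem_univ 0) ht.le (sub_nonneg.2 ht1) (by ring)
  simp only [smul_eq_mul, mul_zero, add_zero, h0] at hc
  have habs : |δ / |x| * x| = δ := by
    rw [abs_mul, abs_of_pos ht]
    field_simp
  have hq := h _ habs.le
  rw [← sq_abs, habs] at hq
  have hmul : δ ^ 2 / 4 ≤ δ * (f x / |x|) := by
    calc _ ≤ δ / |x| * f x := hq.trans hc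
      _ = _ := by ring
  have hle : δ / 4 ≤ f x / |x| := by
    refine le_of_mul_le_mul_left ?_ hδ
    linarith
  rw [le_div_iff₀ hx0] at hle
  linarith

theorem integrable_exp_neg_abs : Integrable (fun x : ℝ => Real.exp (-|x|)) := by
  rw [← integrableOn_univ, ← Set.Iic_union_Ioi (a := (0 : ℝ))]
  refine IntegrableOn.union ?_ ?_
  · refine (integrableOn_exp_Iic 0).congr_fun (fun x hx => ?_) measurableSet_Iic
    simp [abs_of_nonpos (Set.mem_Iic.1 hx)]
  · refine (integrableOn_exp_neg_Ioi 0).congr_fun (fun x hx => ?_) measurableSet_Ioi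
    simp [abs_of_pos (Set.mem_Ioi.1 hx)]

/-- Fix `b > 0` and `λ ∈ ℝ`. Under Assumption 2.1 on the potential `V`, there exist
`β_c ∈ (0,1]` and `C > 0` such that for every `β ∈ (0, β_c)` the partition function
`Z_{β,b,λ} = ∫_ℝ exp(-b V_β(η) + λη) dη` is finite and bounded by `C`, where
`V_β(η) = β⁻² V(βη)`. -/
theorem partition_function_finite
    (V : ℝ → ℝ) (γV M : ℝ) (hγV : 0 < γV) (hM : 0 < M)
    (hsmooth : ContDiff ℝ (⊤ : ℕ∞) V) (hconv : ConvexOn ℝ Set.univ V)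
    (hnonneg : ∀ x : ℝ, 0 ≤ V x) (hV0 : V 0 = 0) (hV'0 : deriv V 0 = 0)
    (hV''0 : iteratedDeriv 2 V 0 = 1)
    (hgrowth : ∀ k : ℕ, k ≤ 5 → ∀ x : ℝ, |iteratedDeriv k V x| ≤ M * Real.exp (γV * |x|))
    (b lam : ℝ) (hb : 0 < b) :
    ∃ βc ∈ Set.Ioc (0 : ℝ) 1, ∃ C > (0 : ℝ), ∀ β ∈ Set.Ioo (0 : ℝ) βc,
      Integrable (fun η : ℝ => Real.exp (-b * (V (β * η) / β ^ 2) + lam * η)) ∧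
      (∫ η : ℝ, Real.exp (-b * (V (β * η) / β ^ 2) + lam * η)) ≤ C := by
  obtain ⟨δ, hδ, hquad⟩ := exists_quarter_sq_le (hsmooth.of_le (WithTop.coe_le_coe.2 (le_top (a := (2 : ℕ∞))))) hV0 hV'0 hV''0
  set A := |lam| + 1 with hA
  have hApos : 0 < A := by positivity
  have hlower : ∀ β ∈ Set.Ioo (0 : ℝ) (min 1 (b * δ / (4 * A))), ∀ η : ℝ,
      A * |η| - A ^ 2 / b ≤ b * (V (β * η) / β ^ 2) := by
    rintro β ⟨hβ, hβ'⟩ η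
    have hβA : β * (4 * A) ≤ b * δ :=
      ((le_div_iff₀ (by positivity)).1 (hβ'.le.trans (min_le_right _ _)))
    rcases le_total |β * η| δ with hle | hge
    · have hV : η ^ 2 / 4 ≤ V (β * η) / β ^ 2 := by
        rw [le_div_iff₀ (by positivity)]
        linarith [hquad _ hle, mul_pow β η 2]
      have hsq : A * |η| - A ^ 2 / b ≤ b * (|η| ^ 2 / 4) := by
        have h : b * (|η| ^ 2 / 4) - (A * |η| - A ^ 2 / b) = b * (|η| / 2 - A / b) ^ 2 := by
          field_simp
          ring
        have : 0 ≤ b * (|η| / 2 - A / b) ^ 2 := by positivity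
        linarith
      rw [sq_abs] at hsq
      exact hsq.trans (mul_le_mul_of_nonneg_left hV hb.le)
    · have hV := hconv.linear_le_of_quarter_sq_le hV0 hδ hquad hge
      rw [abs_mul, abs_of_pos hβ] at hV
      have hV' : A * |η| ≤ b * (V (β * η) / β ^ 2) := by
        rw [← mul_div_assoc, le_div_iff₀ (by positivity)]
        calc A * |η| * β ^ 2 = β * (4 * A) * (β * |η| / 4) := by ring
          _ ≤ b * δ * (β * |η| / 4) := by gcongr
          _ = b * (δ * (β * |η|) / 4) := by ring
          _ ≤ b * V (β * η) := by gcongr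
      have : 0 ≤ A ^ 2 / b := by positivity
      linarith
  have hint : Integrable (fun η : ℝ => Real.exp (A ^ 2 / b) * Real.exp (-|η|)) :=
    integrable_exp_neg_abs.const_mul _
  refine ⟨min 1 (b * δ / (4 * A)), ⟨by positivity, min_le_left _ _⟩,
    (∫ η : ℝ, Real.exp (A ^ 2 / b) * Real.exp (-|η|)) + 1, ?_, fun β hβ => ?_⟩
  · have : 0 ≤ ∫ η : ℝ, Real.exp (A ^ 2 / b) * Real.exp (-|η|) :=
      integral_nonneg fun η => by positivity
    linarith
  have hbound : ∀ η : ℝ, Real.exp (-b * (V (β * η) / β ^ 2) + lam * η) ≤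
      Real.exp (A ^ 2 / b) * Real.exp (-|η|) := by
    intro η
    rw [← Real.exp_add, Real.exp_le_exp]
    have h := hlower β hβ η
    have hlam : lam * η ≤ |lam| * |η| := (le_abs_self _).trans (abs_mul _ _).le
    rw [show A * |η| = |lam| * |η| + |η| by rw [hA]; ring] at h
    linarith
  have hcont : Continuous V := hsmooth.continuous
  have hI : Integrable (fun η : ℝ => Real.exp (-b * (V (β * η) / β ^ 2) + lam * η)) := by
    refine hint.mono' (Continuous.aestronglyMeasurable (by fun_prop)) (.of_forall fun η => ?_)
    rw [Real.norm_eq_abs, Real.abs_exp]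
    exact hbound η
  refine ⟨hI, ?_⟩
  linarith [integral_mono hI hint hbound]
end

section
/- Fix b > 0 and λ ∈ ℝ. For every γ > 0 there exist a constant C_γ > 0 and β_c = β_c(γ) ∈ (0,1] such that for all β ∈ (0, β_c) the partition function Z_{β,b,λ} is finite and ∫_ℝ e^{γ|η|} dν_{β,b,λ}(η) ≤ C_γ; that is, the exponential moments of the Gibbs measures ν_{β,b,λ} are bounded uniformly over β ∈ (0, β_c). -/
open MeasureTheory

/-- The unnormalized Gibbs density `exp(-b V_β(η) + λ η)` with `V_β(η) = β⁻² V(βη)`. -/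
noncomputable def gibbsDensity (V : ℝ → ℝ) (β b lam : ℝ) (η : ℝ) : ℝ :=
  Real.exp (-b * (V (β * η) / β ^ 2) + lam * η)

/-- The partition function `Z_{β,b,λ}`. -/
noncomputable def partitionZ (V : ℝ → ℝ) (β b lam : ℝ) : ℝ :=
  ∫ η : ℝ, gibbsDensity V β b lam η

/-- The Gibbs probability measure `ν_{β,b,λ}` with density `Z⁻¹ exp(-b V_β(η) + λη)`
with respect to Lebesgue measure. -/
noncomputable def gibbsMeasure (V : ℝ → ℝ) (β b lam : ℝ) : Measure ℝ :=
  (volume : Measure ℝ).withDensity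
    (fun η => ENNReal.ofReal (gibbsDensity V β b lam η / partitionZ V β b lam))

/-- A function with `V 0 = V' 0 = 0` and `V'' 0 = 1` is comparable to `x²` near the origin. -/
theorem exists_quadratic_bounds_near_zero {V : ℝ → ℝ} (hV : ContDiff ℝ 2 V) (hV0 : V 0 = 0)
    (hV'0 : deriv V 0 = 0) (hV''0 : iteratedDeriv 2 V 0 = 1) :
    ∃ δ > (0 : ℝ), δ ≤ 1 ∧ ∀ x : ℝ, |x| ≤ δ → x ^ 2 / 4 ≤ V x ∧ V x ≤ x ^ 2 := by
  have h := taylor_isLittleO_univ (x₀ := 0) (n := 2) (f := V) hV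
  have hT (x : ℝ) : taylorWithinEval V 2 Set.univ 0 x = x ^ 2 / 2 := by
    simp only [taylorWithinEval_succ, taylor_within_zero_eval, iteratedDerivWithin_univ]
    norm_num [hV0, hV'0, hV''0, iteratedDeriv_one]
    ring
  simp only [hT, sub_zero] at h
  obtain ⟨ε, hε, hball⟩ := Metric.eventually_nhds_iff.1 (h.bound (show (0 : ℝ) < 1 / 4 by norm_num))
  refine ⟨min (ε / 2) 1, by positivity, min_le_right _ _, fun x hx => ?_⟩
  have hxε : |x| < ε := by linarith [hx.trans (min_le_left _ _)]
  have hb := @hball x (by simpa using hxε)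
  rw [Real.norm_eq_abs, Real.norm_eq_abs, abs_of_nonneg (sq_nonneg x), abs_le] at hb
  constructor <;> nlinarith [sq_nonneg x, hb.1, hb.2]

/-- A convex function vanishing at the origin and at least `x² / 4` on `[-δ, δ]` grows at least
linearly with slope `δ / 4` outside `[-δ, δ]`. -/
theorem ConvexOn.linear_lower_bound_of_quadratic {V : ℝ → ℝ} (hconv : ConvexOn ℝ Set.univ V)
    (hV0 : V 0 = 0) {δ : ℝ} (hδ : 0 < δ) (hquad : ∀ x : ℝ, |x| ≤ δ → x ^ 2 / 4 ≤ V x)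
    {x : ℝ} (hx : δ ≤ |x|) : δ / 4 * |x| ≤ V x := by
  have hx0 : 0 < |x| := hδ.trans_le hx
  have ht : δ / |x| ≤ 1 := (div_le_one hx0).2 hx
  have hc := hconv.2 (Set.mem_univ x) (Set.mem_univ 0)
    (show 0 ≤ δ / |x| by positivity) (sub_nonneg.2 ht) (by ring)
  simp only [smul_eq_mul, mul_zero, add_zero, hV0] at hc
  have habs : |δ / |x| * x| = δ := by
    rw [abs_mul, abs_div, abs_abs, abs_of_pos hδ, div_mul_cancel₀ _ hx0.ne']
  have hq := hquad _ habs.le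
  rw [← sq_abs, habs] at hq
  have h := mul_le_mul_of_nonneg_right (hq.trans hc) hx0.le
  have he : δ / |x| * V x * |x| = δ * V x := by field_simp
  rw [he] at h
  refine le_of_mul_le_mul_left ?_ hδ
  linarith

/-- The rescaled potential dominates any linear function, up to a constant independent of `β`,
as soon as `β` is small enough. -/
theorem linear_le_rescaled_potential {V : ℝ → ℝ} (hconv : ConvexOn ℝ Set.univ V)
    (hV0 : V 0 = 0) {δ : ℝ} (hδ : 0 < δ) (hquad : ∀ x : ℝ, |x| ≤ δ → x ^ 2 / 4 ≤ V x)
    {b L β : ℝ} (hb : 0 < b) (hβ : 0 < β) (hβL : 4 * L * β ≤ b * δ) (η : ℝ) :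
    L * |η| - L ^ 2 / b ≤ b * (V (β * η) / β ^ 2) := by
  have habs : |β * η| = β * |η| := by rw [abs_mul, abs_of_pos hβ]
  rcases le_total |β * η| δ with h | h
  · have hq : η ^ 2 / 4 ≤ V (β * η) / β ^ 2 := by
      rw [le_div_iff₀ (by positivity)]
      linarith [hquad _ h]
    have hsq : 0 ≤ (b * |η| / 2 - L) ^ 2 / b := by positivity
    have he : (b * |η| / 2 - L) ^ 2 / b = b * (η ^ 2 / 4) - (L * |η| - L ^ 2 / b) := by
      rw [← sq_abs η]
      field_simp
      ring
    linarith [mul_le_mul_of_nonneg_left hq hb.le]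
  · have hq := hconv.linear_lower_bound_of_quadratic hV0 hδ hquad h
    rw [habs] at hq
    have hL : L * |η| ≤ b * (V (β * η) / β ^ 2) := by
      rw [← mul_div_assoc, le_div_iff₀ (by positivity)]
      have h1 := mul_le_mul_of_nonneg_right hβL (by positivity : 0 ≤ β * |η|)
      have h2 := mul_le_mul_of_nonneg_left hq hb.le
      linarith
    have : 0 ≤ L ^ 2 / b := by positivity
    linarith

theorem exp_mul_abs_mul_gibbsDensity_le {V : ℝ → ℝ} (hconv : ConvexOn ℝ Set.univ V)
    (hV0 : V 0 = 0) {δ : ℝ} (hδ : 0 < δ) (hquad : ∀ x : ℝ, |x| ≤ δ → x ^ 2 / 4 ≤ V x)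
    {b lam γ β : ℝ} (hb : 0 < b) (hβ : 0 < β) (hβL : 4 * (γ + |lam| + 1) * β ≤ b * δ) (η : ℝ) :
    Real.exp (γ * |η|) * gibbsDensity V β b lam η
      ≤ Real.exp ((γ + |lam| + 1) ^ 2 / b) * Real.exp (-|η|) := by
  rw [gibbsDensity, ← Real.exp_add, ← Real.exp_add, Real.exp_le_exp]
  have h := linear_le_rescaled_potential hconv hV0 hδ hquad hb hβ hβL η
  have hl : lam * η ≤ |lam| * |η| := (le_abs_self _).trans (abs_mul _ _).le
  linarith

theorem continuous_gibbsDensity {V : ℝ → ℝ} (hV : Continuous V) (β b lam : ℝ) :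
    Continuous (gibbsDensity V β b lam) := by
  unfold gibbsDensity
  fun_prop

theorem le_partitionZ {V : ℝ → ℝ} {δ : ℝ} (hδ : 0 < δ) (hδ1 : δ ≤ 1)
    (hquad : ∀ x : ℝ, |x| ≤ δ → V x ≤ x ^ 2) {b lam β : ℝ} (hb : 0 < b) (hβ : 0 < β)
    (hβ1 : β ≤ 1) (hint : Integrable (gibbsDensity V β b lam)) :
    Real.exp (-b - |lam|) * δ ≤ partitionZ V β b lam := by
  have hle : ∀ η ∈ Set.Icc (0 : ℝ) δ, Real.exp (-b - |lam|) ≤ gibbsDensity V β b lam η := by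
    rintro η ⟨h0, h1⟩
    rw [gibbsDensity, Real.exp_le_exp]
    have hV : V (β * η) / β ^ 2 ≤ 1 := by
      rw [div_le_one (by positivity)]
      refine (hquad (β * η) ?_).trans ?_
      · rw [abs_of_nonneg (by positivity)]
        nlinarith
      · rw [mul_pow]
        exact mul_le_of_le_one_right (by positivity) (pow_le_one₀ h0 (h1.trans hδ1))
    have hl : -|lam| ≤ lam * η := by
      have := neg_abs_le (lam * η)
      rw [abs_mul, abs_of_nonneg h0] at this
      nlinarith [abs_nonneg lam]
    nlinarith
  have h := setIntegral_ge_of_const_le_real measurableSet_Icc (by simp) hle hint.integrableOn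
  rw [Real.volume_real_Icc_of_le hδ.le, sub_zero] at h
  exact h.trans (setIntegral_le_integral hint (ae_of_all _ fun η => (Real.exp_pos _).le))

/-- Fix `b > 0` and `λ ∈ ℝ`. Under Assumption 2.1 on `V`, for every `γ > 0` there exist
`C_γ > 0` and `β_c = β_c(γ) ∈ (0,1]` such that for all `β ∈ (0, β_c)` the partition
function is finite and `∫ e^{γ|η|} dν_{β,b,λ}(η) ≤ C_γ`: the exponential moments of the
Gibbs measures are bounded uniformly over `β ∈ (0, β_c)`. -/
theorem uniform_exponential_moment_bound
    (V : ℝ → ℝ) (γV M : ℝ) (hγV : 0 < γV) (hM : 0 < M)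
    (hsmooth : ContDiff ℝ (⊤ : ℕ∞) V) (hconv : ConvexOn ℝ Set.univ V)
    (hnonneg : ∀ x : ℝ, 0 ≤ V x) (hV0 : V 0 = 0) (hV'0 : deriv V 0 = 0)
    (hV''0 : iteratedDeriv 2 V 0 = 1)
    (hgrowth : ∀ k : ℕ, k ≤ 5 → ∀ x : ℝ, |iteratedDeriv k V x| ≤ M * Real.exp (γV * |x|))
    (b lam : ℝ) (hb : 0 < b) (γ : ℝ) (hγ : 0 < γ) :
    ∃ C > (0 : ℝ), ∃ βc ∈ Set.Ioc (0 : ℝ) 1, ∀ β ∈ Set.Ioo (0 : ℝ) βc,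
      Integrable (gibbsDensity V β b lam) ∧
      (∫⁻ η : ℝ, ENNReal.ofReal (Real.exp (γ * |η|)) ∂(gibbsMeasure V β b lam))
        ≤ ENNReal.ofReal C := by
  have hcont : Continuous V := hsmooth.continuous
  obtain ⟨δ, hδ, hδ1, hquad⟩ := exists_quadratic_bounds_near_zero
    (contDiff_infty.1 hsmooth 2) hV0 hV'0 hV''0
  have hL : 0 < γ + |lam| + 1 := by positivity
  set D := Real.exp ((γ + |lam| + 1) ^ 2 / b)
  set z := Real.exp (-b - |lam|) * δ
  have hz : 0 < z := by positivity
  have hI : 0 < ∫ x : ℝ, Real.exp (-|x|) := integral_exp_pos integrable_exp_neg_abs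
  refine ⟨D / z * ∫ x : ℝ, Real.exp (-|x|), by positivity,
    min 1 (b * δ / (4 * (γ + |lam| + 1))), ⟨by positivity, min_le_left _ _⟩, ?_⟩
  rintro β ⟨hβ, hβc⟩
  have hβ1 : β ≤ 1 := hβc.le.trans (min_le_left _ _)
  have hβL : 4 * (γ + |lam| + 1) * β ≤ b * δ := by
    rw [mul_comm, ← le_div_iff₀ (by positivity)]
    exact hβc.le.trans (min_le_right _ _)
  have hbound := exp_mul_abs_mul_gibbsDensity_le (lam := lam) (γ := γ) hconv hV0 hδ
    (fun x hx => (hquad x hx).1) hb hβ hβL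
  have hgcont := continuous_gibbsDensity hcont β b lam
  have hgpos (η : ℝ) : 0 < gibbsDensity V β b lam η := Real.exp_pos _
  have hint : Integrable (gibbsDensity V β b lam) := by
    refine (integrable_exp_neg_abs.const_mul D).mono' hgcont.aestronglyMeasurable
      (ae_of_all _ fun η => ?_)
    rw [Real.norm_of_nonneg (hgpos η).le]
    exact (le_mul_of_one_le_left (hgpos η).le (Real.one_le_exp (by positivity))).trans (hbound η)
  refine ⟨hint, ?_⟩
  have hZ : z ≤ partitionZ V β b lam :=
    le_partitionZ hδ hδ1 (fun x hx => (hquad x hx).2) hb hβ hβ1 hint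
  rw [gibbsMeasure, lintegral_withDensity_eq_lintegral_mul _ (by fun_prop) (by fun_prop),
    ← integral_const_mul, ofReal_integral_eq_lintegral_ofReal
      (integrable_exp_neg_abs.const_mul _) (ae_of_all _ fun η => by positivity)]
  refine lintegral_mono fun η => ?_
  rw [Pi.mul_apply, ← ENNReal.ofReal_mul (div_nonneg (hgpos η).le (hz.le.trans hZ))]
  refine ENNReal.ofReal_le_ofReal ?_
  rw [div_mul_eq_mul_div, mul_comm (gibbsDensity V β b lam η), div_mul_eq_mul_div]
  exact div_le_div₀ (by positivity) (hbound η) hz hZ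
end

section
/- Fix b > 0 and λ ∈ ℝ. Then lim_{β→0⁺} Z_{β,b,λ} = ∫_ℝ exp(−b·η²/2 + λη) dη = √(2π/b)·exp(λ²/(2b)); that is, as the inverse temperature β tends to 0, the partition function converges to the Gaussian partition function. -/
open MeasureTheory Filter

/-- Completing the square in a Gaussian exponent. -/
lemma exp_quadratic_eq {a : ℝ} (ha : a ≠ 0) (c x : ℝ) :
    Real.exp (-a * x ^ 2 + c * x) =
      Real.exp (-a * (x - c / (2 * a)) ^ 2) * Real.exp (c ^ 2 / (4 * a)) := by
  rw [← Real.exp_add]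
  congr 1
  field_simp
  ring

lemma integrable_exp_quadratic {a : ℝ} (ha : 0 < a) (c : ℝ) :
    Integrable fun x : ℝ => Real.exp (-a * x ^ 2 + c * x) := by
  simp_rw [exp_quadratic_eq ha.ne']
  exact ((integrable_exp_neg_mul_sq ha).comp_sub_right (c / (2 * a))).mul_const _

lemma integral_exp_quadratic {a : ℝ} (ha : 0 < a) (c : ℝ) :
    ∫ x : ℝ, Real.exp (-a * x ^ 2 + c * x) =
      Real.sqrt (Real.pi / a) * Real.exp (c ^ 2 / (4 * a)) := by
  simp_rw [exp_quadratic_eq ha.ne']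
  rw [integral_mul_const,
    integral_sub_right_eq_self (fun x : ℝ => Real.exp (-a * x ^ 2)), integral_gaussian]

/-- A function vanishing to first order at `0` satisfies `f x / x ^ 2 → f'' 0 / 2`. -/
lemma tendsto_div_sq_of_hasDerivAt_deriv {f : ℝ → ℝ} {c : ℝ} (hf : Differentiable ℝ f)
    (h0 : f 0 = 0) (h1 : deriv f 0 = 0) (h2 : HasDerivAt (deriv f) c 0) :
    Tendsto (fun x => f x / x ^ 2) (nhdsWithin 0 {0}ᶜ) (nhds (c / 2)) := by
  refine HasDerivAt.lhopital_zero_nhdsNE (f' := deriv f) (g' := fun x => 2 * x)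
    (.of_forall fun x => (hf x).hasDerivAt)
    (.of_forall fun x => by simpa using hasDerivAt_pow 2 x) ?_ ?_ ?_ ?_
  · filter_upwards [self_mem_nhdsWithin] with x hx
    simpa using hx
  · exact (h0 ▸ hf.continuous.tendsto 0).mono_left nhdsWithin_le_nhds
  · have : Tendsto (fun x : ℝ => x ^ 2) (nhds 0) (nhds (0 ^ 2)) :=
      (continuous_pow 2).tendsto 0
    exact (by simpa using this : Tendsto (fun x : ℝ => x ^ 2) (nhds 0) (nhds 0)).mono_left
      nhdsWithin_le_nhds
  · refine ((hasDerivAt_iff_tendsto_slope.1 h2).div_const 2).congr fun x => ?_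
    rw [slope_def_field, h1]
    simp only [sub_zero]
    rw [div_div, mul_comm]

/-- If a convex `f` with `f 0 = 0` dominates `x ^ 2 / 4` on `[-δ, δ]`, then it dominates
`δ |x| / 4` outside of that interval. -/
lemma ConvexOn.linear_lower_bound {f : ℝ → ℝ} (hf : ConvexOn ℝ Set.univ f) (h0 : f 0 = 0)
    {δ : ℝ} (hδ : 0 < δ) (hloc : ∀ x, |x| ≤ δ → x ^ 2 / 4 ≤ f x) {x : ℝ} (hx : δ < |x|) :
    δ * |x| / 4 ≤ f x := by
  have hx0 : 0 < |x| := hδ.trans hx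
  set t := δ / |x| with ht
  have ht0 : 0 < t := div_pos hδ hx0
  have ht1 : t ≤ 1 := (div_le_one hx0).2 hx.le
  have htx : t * |x| = δ := div_mul_cancel₀ _ hx0.ne'
  have hconv := hf.2 (Set.mem_univ x) (Set.mem_univ 0) ht0.le (sub_nonneg.2 ht1)
    (add_sub_cancel t 1)
  simp only [smul_eq_mul, mul_zero, add_zero, h0] at hconv
  have h := hloc (t * x) (by rw [abs_mul, abs_of_pos ht0, htx])
  refine le_of_mul_le_mul_left ?_ ht0
  have hsq : (t * x) ^ 2 = t * (δ * |x|) := by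
    rw [mul_pow, ← sq_abs x, ← htx]
    ring
  linarith

lemma exp_neg_abs_le (x : ℝ) : Real.exp (-|x|) ≤ 2 * (1 + x ^ 2)⁻¹ := by
  have h := Real.quadratic_le_exp_of_nonneg (abs_nonneg x)
  rw [sq_abs] at h
  rw [Real.exp_neg, ← div_eq_mul_inv, inv_eq_one_div,
    div_le_div_iff₀ (Real.exp_pos _) (by positivity)]
  linarith [abs_nonneg x]

/-- Fix `b > 0` and `λ ∈ ℝ`. Under Assumption 2.1 on `V`, as the inverse temperature
`β` tends to `0⁺`, the partition function `Z_{β,b,λ} = ∫ exp(-b V_β(η) + λη) dη`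
converges to the Gaussian partition function
`∫ exp(-b η²/2 + λη) dη = √(2π/b) exp(λ²/(2b))`. -/
theorem partition_function_high_temperature_limit
    (V : ℝ → ℝ) (γV M : ℝ) (hγV : 0 < γV) (hM : 0 < M)
    (hsmooth : ContDiff ℝ (⊤ : ℕ∞) V) (hconv : ConvexOn ℝ Set.univ V)
    (hnonneg : ∀ x : ℝ, 0 ≤ V x) (hV0 : V 0 = 0) (hV'0 : deriv V 0 = 0)
    (hV''0 : iteratedDeriv 2 V 0 = 1)
    (hgrowth : ∀ k : ℕ, k ≤ 5 → ∀ x : ℝ, |iteratedDeriv k V x| ≤ M * Real.exp (γV * |x|))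
    (b lam : ℝ) (hb : 0 < b) :
    (∫ η : ℝ, Real.exp (-b * η ^ 2 / 2 + lam * η))
        = Real.sqrt (2 * Real.pi / b) * Real.exp (lam ^ 2 / (2 * b)) ∧
    Tendsto (fun β : ℝ => ∫ η : ℝ, Real.exp (-b * (V (β * η) / β ^ 2) + lam * η))
      (nhdsWithin 0 (Set.Ioi 0))
      (nhds (Real.sqrt (2 * Real.pi / b) * Real.exp (lam ^ 2 / (2 * b)))) := by
  have hgauss : (∫ η : ℝ, Real.exp (-b * η ^ 2 / 2 + lam * η))
      = Real.sqrt (2 * Real.pi / b) * Real.exp (lam ^ 2 / (2 * b)) := by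
    have h := integral_exp_quadratic (half_pos hb) lam
    rw [show Real.pi / (b / 2) = 2 * Real.pi / b by field_simp,
      show 4 * (b / 2) = 2 * b by ring] at h
    rw [← h]
    congr 1
    ext η
    congr 1
    ring
  refine ⟨hgauss, ?_⟩
  rw [← hgauss]
  have hdiff : Differentiable ℝ V := hsmooth.differentiable (by simp)
  have hderiv2 : HasDerivAt (deriv V) 1 0 := by
    have hd : Differentiable ℝ (deriv V) := by
      simpa [iteratedDeriv_one] using
        hsmooth.differentiable_iteratedDeriv 1 (by exact_mod_cast WithTop.coe_lt_top 1)
    rw [iteratedDeriv_succ, iteratedDeriv_one] at hV''0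
    exact hV''0 ▸ (hd 0).hasDerivAt
  have hlim := tendsto_div_sq_of_hasDerivAt_deriv hdiff hV0 hV'0 hderiv2
  obtain ⟨δ, hδ, hloc⟩ : ∃ δ > 0, ∀ x, |x| ≤ δ → x ^ 2 / 4 ≤ V x := by
    have hev := hlim.eventually (lt_mem_nhds (show (1 / 4 : ℝ) < 1 / 2 by norm_num))
    rw [eventually_nhdsWithin_iff] at hev
    obtain ⟨ε, hε, h⟩ := Metric.eventually_nhds_iff.1 hev
    refine ⟨ε / 2, half_pos hε, fun x hx => ?_⟩
    rcases eq_or_ne x 0 with rfl | hx0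
    · simp [hV0]
    · have h' := h (by rw [Real.dist_eq, sub_zero]; linarith) hx0
      rw [lt_div_iff₀ (by positivity)] at h'
      linarith
  have hβ₀ : 0 < b * δ / (4 * (|lam| + 1)) := by positivity
  refine tendsto_integral_filter_of_dominated_convergence
    (fun η => Real.exp (-(b / 4) * η ^ 2 + lam * η) + 2 * (1 + η ^ 2)⁻¹) ?_ ?_
    ((integrable_exp_quadratic (by positivity) lam).add
      (integrable_inv_one_add_sq.const_mul 2)) ?_
  · refine .of_forall fun β => Continuous.aestronglyMeasurable ?_
    have := hdiff.continuous
    fun_prop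
  · filter_upwards [Ioo_mem_nhdsGT hβ₀] with β hβ
    obtain ⟨hβ0, hβ1⟩ := hβ
    refine .of_forall fun η => ?_
    rw [Real.norm_eq_abs, Real.abs_exp]
    rcases le_or_gt |β * η| δ with h | h
    · have hV : η ^ 2 / 4 ≤ V (β * η) / β ^ 2 := by
        rw [le_div_iff₀ (by positivity)]
        linarith [hloc _ h, mul_pow β η 2]
      have hexp : Real.exp (-b * (V (β * η) / β ^ 2) + lam * η) ≤
          Real.exp (-(b / 4) * η ^ 2 + lam * η) := by
        refine Real.exp_le_exp.2 ?_
        linarith [mul_le_mul_of_nonneg_left hV hb.le]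
      exact hexp.trans (le_add_of_nonneg_right (by positivity))
    · have hV : (|lam| + 1) * |η| ≤ b * (V (β * η) / β ^ 2) := by
        have hlin := hconv.linear_lower_bound hV0 hδ hloc h
        rw [abs_mul, abs_of_pos hβ0] at hlin
        rw [lt_div_iff₀ (by positivity)] at hβ1
        rw [← mul_div_assoc, le_div_iff₀ (by positivity)]
        have h1 := mul_le_mul_of_nonneg_left hlin hb.le
        have h2 := mul_le_mul_of_nonneg_right hβ1.le (mul_nonneg hβ0.le (abs_nonneg η))
        linarith
      have hexp : Real.exp (-b * (V (β * η) / β ^ 2) + lam * η) ≤ Real.exp (-|η|) := by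
        refine Real.exp_le_exp.2 ?_
        linarith [(le_abs_self (lam * η)).trans_eq (abs_mul lam η)]
      exact (hexp.trans (exp_neg_abs_le η)).trans (le_add_of_nonneg_left (Real.exp_nonneg _))
  · refine .of_forall fun η => ?_
    refine (Real.continuous_exp.tendsto _).comp (Tendsto.add_const _ ?_)
    rw [mul_div_assoc]
    refine Tendsto.const_mul _ ?_
    rcases eq_or_ne η 0 with rfl | hη
    · simp [hV0]
    have hscale : Tendsto (fun β : ℝ => β * η) (nhdsWithin 0 (Set.Ioi 0))
        (nhdsWithin 0 {0}ᶜ) := by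
      refine tendsto_nhdsWithin_iff.2 ⟨?_, ?_⟩
      · have : Tendsto (fun β : ℝ => β * η) (nhds 0) (nhds (0 * η)) :=
          (continuous_mul_const η).tendsto 0
        exact (zero_mul η ▸ this).mono_left nhdsWithin_le_nhds
      · filter_upwards [self_mem_nhdsWithin] with β hβ
        exact mul_ne_zero (ne_of_gt hβ) hη
    have h := (hlim.comp hscale).const_mul (η ^ 2)
    rw [mul_one_div] at h
    refine h.congr fun β => ?_
    simp only [Function.comp_apply, mul_pow]
    rw [mul_comm (β ^ 2), ← div_div, mul_div_assoc', mul_div_assoc',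
      mul_div_cancel_left₀ _ (pow_ne_zero 2 hη)]
end

section
/- For every K > 0 there exists β_c ∈ (0,1] such that for all β ∈ (0, β_c) and all η ∈ ℝ, the rescaled potential satisfies β^{−2}·V(βη) ≥ (K/2)·(|η| − K). -/
/-- A differentiable convex function on `ℝ` lies above each of its tangent lines. -/
theorem ConvexOn.tangent_line_le {f : ℝ → ℝ} (hf : ConvexOn ℝ Set.univ f)
    (hd : Differentiable ℝ f) (x y : ℝ) : f y + deriv f y * (x - y) ≤ f x := by
  rcases lt_trichotomy x y with h | rfl | h
  · have := hf.slope_le_deriv (Set.mem_univ x) (Set.mem_univ y) h (hd y)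
    rw [slope_def_field, div_le_iff₀ (by linarith)] at this
    linarith
  · simp
  · have := hf.deriv_le_slope (Set.mem_univ y) (Set.mem_univ x) h (hd y)
    rw [slope_def_field, le_div_iff₀ (by linarith)] at this
    linarith

/-- Under Assumption 2.1 on `V`, for every `K > 0` there exists `β_c ∈ (0,1]` such that
for all `β ∈ (0, β_c)` and all `η ∈ ℝ`, the rescaled potential satisfies
`β⁻² V(βη) ≥ (K/2)(|η| - K)`. -/
theorem rescaled_potential_linear_lower_bound
    (V : ℝ → ℝ) (γV M : ℝ) (hγV : 0 < γV) (hM : 0 < M)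
    (hsmooth : ContDiff ℝ (⊤ : ℕ∞) V) (hconv : ConvexOn ℝ Set.univ V)
    (hnonneg : ∀ x : ℝ, 0 ≤ V x) (hV0 : V 0 = 0) (hV'0 : deriv V 0 = 0)
    (hV''0 : iteratedDeriv 2 V 0 = 1)
    (hgrowth : ∀ k : ℕ, k ≤ 5 → ∀ x : ℝ, |iteratedDeriv k V x| ≤ M * Real.exp (γV * |x|))
    (K : ℝ) (hK : 0 < K) :
    ∃ βc ∈ Set.Ioc (0 : ℝ) 1, ∀ β ∈ Set.Ioo (0 : ℝ) βc, ∀ η : ℝ,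
      (K / 2) * (|η| - K) ≤ V (β * η) / β ^ 2 := by
  have hdiff : Differentiable ℝ V := hsmooth.differentiable (by simp)
  have hderiv : HasDerivAt (deriv V) 1 0 := by
    have hV2 : deriv (deriv V) 0 = 1 := by
      rw [iteratedDeriv_succ, iteratedDeriv_one] at hV''0
      exact hV''0
    rw [← hV2]
    exact (differentiableAt_of_deriv_ne_zero (by rw [hV2]; exact one_ne_zero)).hasDerivAt
  obtain ⟨δ, hδ, hnear⟩ := Metric.eventually_nhds_iff.1
    (hderiv.isLittleO.bound (show (0 : ℝ) < 1 / 2 by norm_num))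
  have hclose : ∀ y : ℝ, |y| < δ → |deriv V y - y| ≤ 1 / 2 * |y| := by
    intro y hy
    simpa [hV'0] using hnear (y := y) (by simpa using hy)
  refine ⟨min 1 (δ / K), ⟨lt_min one_pos (div_pos hδ hK), min_le_left _ _⟩, ?_⟩
  rintro β ⟨hβ, hβc⟩ η
  have hβK : β * K < δ := (lt_div_iff₀ hK).1 (hβc.trans_le (min_le_right _ _))
  have hpos : 0 < β * K := mul_pos hβ hK
  rcases le_total |η| K with hη | hη
  · exact (mul_nonpos_of_nonneg_of_nonpos (by linarith) (by linarith)).trans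
      (div_nonneg (hnonneg _) (sq_nonneg β))
  rw [le_div_iff₀ (by positivity)]
  have hgap : 0 ≤ β * |η| - β * K := by nlinarith
  rcases le_total 0 η with h | h
  · rw [abs_of_nonneg h] at hη hgap ⊢
    have hs := hclose (β * K) (by rwa [abs_of_pos hpos])
    rw [abs_of_pos hpos, abs_le] at hs
    have ht := hconv.tangent_line_le hdiff (β * η) (β * K)
    have hn := hnonneg (β * K)
    have hm : β * K / 2 ≤ deriv V (β * K) := by linarith
    nlinarith [mul_le_mul_of_nonneg_right hm hgap]
  · rw [abs_of_nonpos h] at hη hgap ⊢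
    have hs := hclose (-(β * K)) (by rwa [abs_neg, abs_of_pos hpos])
    rw [abs_neg, abs_of_pos hpos, abs_le] at hs
    have ht := hconv.tangent_line_le hdiff (β * η) (-(β * K))
    have hn := hnonneg (-(β * K))
    have hm : β * K / 2 ≤ -deriv V (-(β * K)) := by linarith
    nlinarith [mul_le_mul_of_nonneg_right hm hgap]
end

section
/- Let V(η) = e^{−η} − 1 + η be the Toda lattice potential, let b > 0, λ ∈ ℝ and γ > 0. Then for every β₀ with 0 < β₀ < b·(γ + |λ|)^{−1} there exists a constant C > 0 (depending on b, λ, γ, β₀ but not on β) such that ∫_ℝ e^{γ|η|} dν_{β,b,λ}(η) ≤ C for all β ∈ (0, β₀]; in particular the exponential moment E_{ν_{β,b,λ}}[e^{γ|η|}] is finite whenever β^{−1} > b^{−1}(γ + |λ|). -/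
open MeasureTheory

/-- The Toda lattice potential `V(η) = e^{-η} - 1 + η`. -/
noncomputable def todaV (η : ℝ) : ℝ := Real.exp (-η) - 1 + η

/-- The lower half of the Padé bound for `exp (-x)`, in product form. -/
lemma two_sub_le_two_add_mul_exp_neg {x : ℝ} (hx : 0 ≤ x) :
    2 - x ≤ (2 + x) * Real.exp (-x) := by
  have hd (y : ℝ) : HasDerivAt (fun y : ℝ => (2 + y) * Real.exp (-y) + y)
      (1 - (1 + y) * Real.exp (-y)) y := by
    have h := (((hasDerivAt_id y).const_add 2).mul (hasDerivAt_neg y).exp).add (hasDerivAt_id y)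
    refine h.congr_deriv ?_
    simp only [id]
    ring
  have hmono : Monotone (fun y : ℝ => (2 + y) * Real.exp (-y) + y) := by
    refine monotone_of_deriv_nonneg (fun y => (hd y).differentiableAt) fun y => ?_
    rw [(hd y).deriv, sub_nonneg, Real.exp_neg, ← div_eq_mul_inv, div_le_one (Real.exp_pos y)]
    linarith [Real.add_one_le_exp y]
  have h := hmono hx
  simp only [add_zero, neg_zero, Real.exp_zero, mul_one] at h
  linarith

lemma todaV_le_sq {x : ℝ} (hx : 0 ≤ x) : todaV x ≤ x ^ 2 := by
  have h1 : Real.exp (-x) * (1 + x) ≤ 1 := by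
    rw [Real.exp_neg, inv_mul_le_one₀ (Real.exp_pos x)]
    linarith [Real.add_one_le_exp x]
  have h2 : Real.exp (-x) * (1 + x) ≤ (1 - x + x ^ 2) * (1 + x) := by
    nlinarith [pow_nonneg hx 3]
  have h3 := le_of_mul_le_mul_right h2 (by linarith)
  unfold todaV
  linarith

/-- The rescaled Toda potential grows at least linearly, uniformly in `β ∈ (0, β₀]`. -/
lemma abs_div_sub_le_rescaled_todaV {β β₀ : ℝ} (hβ : 0 < β) (hββ₀ : β ≤ β₀) (η : ℝ) :
    |η| / β₀ - 2 / β₀ ^ 2 ≤ todaV (β * η) / β ^ 2 := by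
  have hβ₀ : 0 < β₀ := hβ.trans_le hββ₀
  rcases le_total 0 η with hη | hη
  · have hx : 0 ≤ β * η := by positivity
    have hV : (β * η) ^ 2 / (2 + β * η) ≤ todaV (β * η) := by
      rw [div_le_iff₀ (by positivity), todaV]
      nlinarith [two_sub_le_two_add_mul_exp_neg hx]
    calc |η| / β₀ - 2 / β₀ ^ 2 ≤ η ^ 2 / (2 + β₀ * η) := by
          rw [abs_of_nonneg hη, le_div_iff₀ (by positivity)]
          have : (η / β₀ - 2 / β₀ ^ 2) * (2 + β₀ * η) = η ^ 2 - 4 / β₀ ^ 2 := by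
            field_simp
            ring
          rw [this]
          linarith [show 0 ≤ 4 / β₀ ^ 2 by positivity]
      _ ≤ η ^ 2 / (2 + β * η) := by gcongr
      _ = (β * η) ^ 2 / (2 + β * η) / β ^ 2 := by field_simp
      _ ≤ todaV (β * η) / β ^ 2 := by gcongr
  · have hV : (β * η) ^ 2 / 2 ≤ todaV (β * η) := by
      have h := Real.quadratic_le_exp_of_nonneg
        (show 0 ≤ -(β * η) by linarith [mul_nonneg hβ.le (neg_nonneg.2 hη)])
      unfold todaV
      linarith [neg_sq (β * η)]
    calc |η| / β₀ - 2 / β₀ ^ 2 ≤ η ^ 2 / 2 := by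
          have h1 : |η| / β₀ = |η| * β₀⁻¹ := div_eq_mul_inv _ _
          have h2 : 2 / β₀ ^ 2 = 2 * β₀⁻¹ ^ 2 := by rw [div_eq_mul_inv, inv_pow]
          rw [h1, h2, ← sq_abs η]
          nlinarith [sq_nonneg (|η| - β₀⁻¹), sq_nonneg β₀⁻¹]
      _ = (β * η) ^ 2 / 2 / β ^ 2 := by field_simp
      _ ≤ todaV (β * η) / β ^ 2 := by gcongr

lemma continuous_gibbsDensity_todaV (β b lam : ℝ) : Continuous (gibbsDensity todaV β b lam) := by
  unfold gibbsDensity todaV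
  fun_prop

lemma gibbsDensity_pos (V : ℝ → ℝ) (β b lam η : ℝ) : 0 < gibbsDensity V β b lam η :=
  Real.exp_pos _

/-- Exponentially weighted Toda Gibbs densities are dominated uniformly in `β ∈ (0, β₀]`. -/
lemma exp_mul_abs_mul_gibbsDensity_todaV_le {b β β₀ : ℝ} (hb : 0 < b) (hβ : 0 < β)
    (hββ₀ : β ≤ β₀) (lam γ η : ℝ) :
    Real.exp (γ * |η|) * gibbsDensity todaV β b lam η ≤
      Real.exp (2 * b / β₀ ^ 2) * Real.exp (-(b / β₀ - (γ + |lam|)) * |η|) := by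
  rw [gibbsDensity, ← Real.exp_add, ← Real.exp_add, Real.exp_le_exp]
  have h1 := mul_le_mul_of_nonneg_left (abs_div_sub_le_rescaled_todaV hβ hββ₀ η) hb.le
  have h2 : lam * η ≤ |lam| * |η| := (le_abs_self _).trans (abs_mul _ _).le
  have h3 : b * (|η| / β₀ - 2 / β₀ ^ 2) = b / β₀ * |η| - 2 * b / β₀ ^ 2 := by ring
  linarith

lemma integrable_exp_neg_mul_abs {κ : ℝ} (hκ : 0 < κ) :
    Integrable (fun η : ℝ => Real.exp (-κ * |η|)) := by
  rw [← integrableOn_univ, ← Set.Iic_union_Ioi (a := (0 : ℝ))]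
  refine IntegrableOn.union ?_ ?_
  · refine (integrableOn_exp_mul_Iic hκ 0).congr_fun (fun η hη => ?_) measurableSet_Iic
    simp [abs_of_nonpos (Set.mem_Iic.1 hη)]
  · refine (integrableOn_exp_mul_Ioi (neg_lt_zero.2 hκ) 0).congr_fun (fun η hη => ?_)
      measurableSet_Ioi
    simp [abs_of_pos (Set.mem_Ioi.1 hη)]

lemma integrable_gibbsDensity_todaV {b β lam γ : ℝ} (hb : 0 < b) (hβ : 0 < β) (hγ : 0 ≤ γ)
    (hκ : 0 < b / β - (γ + |lam|)) : Integrable (gibbsDensity todaV β b lam) := by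
  refine ((integrable_exp_neg_mul_abs hκ).const_mul (Real.exp (2 * b / β ^ 2))).mono'
    (continuous_gibbsDensity_todaV β b lam).aestronglyMeasurable (ae_of_all _ fun η => ?_)
  have hpos := gibbsDensity_pos todaV β b lam η
  rw [Real.norm_of_nonneg hpos.le]
  refine le_trans ?_ (exp_mul_abs_mul_gibbsDensity_todaV_le hb hβ le_rfl lam γ η)
  exact le_mul_of_one_le_left hpos.le (Real.one_le_exp (by positivity))

/-- A lower bound on the Toda partition function that is uniform in `β`. -/
lemma exp_neg_le_partitionZ_todaV {b β lam : ℝ} (hb : 0 < b) (hβ : 0 < β)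
    (hint : Integrable (gibbsDensity todaV β b lam)) :
    Real.exp (-b - |lam|) ≤ partitionZ todaV β b lam := by
  calc Real.exp (-b - |lam|) = ∫ _ in Set.Icc (0 : ℝ) 1, Real.exp (-b - |lam|) := by simp
    _ ≤ ∫ η in Set.Icc (0 : ℝ) 1, gibbsDensity todaV β b lam η := by
      refine setIntegral_mono_on (integrableOn_const (by simp)) hint.integrableOn
        measurableSet_Icc fun η hη => ?_
      rw [gibbsDensity, Real.exp_le_exp]
      have hV : todaV (β * η) / β ^ 2 ≤ 1 := by
        rw [div_le_one (by positivity)]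
        refine (todaV_le_sq (mul_nonneg hβ.le hη.1)).trans ?_
        exact pow_le_pow_left₀ (mul_nonneg hβ.le hη.1) (mul_le_of_le_one_right hβ.le hη.2) 2
      have hlam : -|lam| ≤ lam * η := by
        have h := neg_abs_le (lam * η)
        rw [abs_mul, abs_of_nonneg hη.1] at h
        exact (neg_le_neg (mul_le_of_le_one_right (abs_nonneg lam) hη.2)).trans h
      nlinarith [mul_le_mul_of_nonneg_left hV hb.le]
    _ ≤ partitionZ todaV β b lam :=
      setIntegral_le_integral hint (ae_of_all _ fun η => (gibbsDensity_pos _ _ _ _ η).le)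

/-- For the Toda lattice potential, `b > 0`, `λ ∈ ℝ` and `γ > 0`: for every `β₀` with
`0 < β₀ < b(γ + |λ|)⁻¹` there is a constant `C > 0` (independent of `β`) such that the
partition function is finite and `∫ e^{γ|η|} dν_{β,b,λ}(η) ≤ C` for all `β ∈ (0, β₀]`;
in particular the exponential moment is finite whenever `β⁻¹ > b⁻¹(γ + |λ|)`. -/
theorem toda_uniform_exponential_moment_bound (b lam γ : ℝ) (hb : 0 < b) (hγ : 0 < γ) :
    ∀ β₀ : ℝ, 0 < β₀ → β₀ < b * (γ + |lam|)⁻¹ →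
      ∃ C > (0 : ℝ), ∀ β ∈ Set.Ioc (0 : ℝ) β₀,
        Integrable (gibbsDensity todaV β b lam) ∧
        (∫⁻ η : ℝ, ENNReal.ofReal (Real.exp (γ * |η|)) ∂(gibbsMeasure todaV β b lam))
          ≤ ENNReal.ofReal C := by
  intro β₀ hβ₀ hlt
  have hs : 0 < γ + |lam| := by positivity
  have hκ : 0 < b / β₀ - (γ + |lam|) := by
    rw [← div_eq_mul_inv, lt_div_iff₀ hs] at hlt
    rw [sub_pos, lt_div_iff₀ hβ₀]
    linarith
  set κ := b / β₀ - (γ + |lam|)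
  set A := Real.exp (2 * b / β₀ ^ 2) / Real.exp (-b - |lam|)
  have hI := (integrable_exp_neg_mul_abs hκ).const_mul A
  have hI0 : 0 ≤ ∫ η : ℝ, A * Real.exp (-κ * |η|) := integral_nonneg fun η => by positivity
  refine ⟨(∫ η : ℝ, A * Real.exp (-κ * |η|)) + 1, by positivity, fun β hβ => ?_⟩
  have hκβ : 0 < b / β - (γ + |lam|) :=
    hκ.trans_le (sub_le_sub_right (div_le_div_of_nonneg_left hb.le hβ.1 hβ.2) _)
  have hint := integrable_gibbsDensity_todaV hb hβ.1 hγ.le hκβ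
  have hZ := exp_neg_le_partitionZ_todaV hb hβ.1 hint
  have hD := (continuous_gibbsDensity_todaV β b lam).measurable
  refine ⟨hint, ?_⟩
  rw [gibbsMeasure, lintegral_withDensity_eq_lintegral_mul _ (by fun_prop) (by fun_prop)]
  calc _ ≤ ∫⁻ η : ℝ, ENNReal.ofReal (A * Real.exp (-κ * |η|)) := by
        refine lintegral_mono fun η => ?_
        have hpos := gibbsDensity_pos todaV β b lam η
        rw [Pi.mul_apply, ← ENNReal.ofReal_mul' (Real.exp_pos _).le]
        refine ENNReal.ofReal_le_ofReal ?_
        calc gibbsDensity todaV β b lam η / partitionZ todaV β b lam * Real.exp (γ * |η|)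
            = Real.exp (γ * |η|) * gibbsDensity todaV β b lam η / partitionZ todaV β b lam := by
              ring
          _ ≤ Real.exp (2 * b / β₀ ^ 2) * Real.exp (-κ * |η|) / Real.exp (-b - |lam|) :=
              div_le_div₀ (by positivity)
                (exp_mul_abs_mul_gibbsDensity_todaV_le hb hβ.1 hβ.2 lam γ η) (Real.exp_pos _) hZ
          _ = A * Real.exp (-κ * |η|) := by ring
    _ = ENNReal.ofReal (∫ η : ℝ, A * Real.exp (-κ * |η|)) :=
        (ofReal_integral_eq_lintegral_ofReal hI (ae_of_all _ fun η => by positivity)).symm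
    _ ≤ _ := ENNReal.ofReal_le_ofReal (by linarith)
end

section
/- Fix b > 0 and λ ∈ ℝ. There exists β_c ∈ (0,1] such that for all β ∈ (0, β_c), the Gibbs measure ν_{β,b,λ} is well defined, the function η ↦ β^{−1}·V'(βη) is ν_{β,b,λ}-integrable, and ∫_ℝ β^{−1}·V'(βη) dν_{β,b,λ}(η) = λ/b; in particular, for b = 1 the mean of ξ = V_β'(η) = β^{−1}V'(βη) under ν_{β,1,λ} equals λ. -/
open MeasureTheory

open Filter Topology Set

/-- If `f` has derivative at least `ε > 0` on `[a, ∞)`, then `exp (-f)` and its derivative are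
integrable on `(a, ∞)`. -/
theorem integrableOn_Ioi_exp_neg_of_le_deriv {f f' : ℝ → ℝ} {a ε : ℝ} (hε : 0 < ε)
    (hf : ∀ x, HasDerivAt f (f' x) x) (hf' : ∀ x ∈ Ici a, ε ≤ f' x) :
    IntegrableOn (fun x => Real.exp (-f x)) (Ioi a) ∧
      IntegrableOn (fun x => Real.exp (-f x) * f' x) (Ioi a) := by
  have hcont : Continuous f := continuous_iff_continuousAt.2 fun x => (hf x).continuousAt
  have hlin : ∀ x ∈ Ici a, f a + ε * (x - a) ≤ f x := by
    intro x hx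
    have := (convex_Ici a).mul_sub_le_image_sub_of_le_deriv hcont.continuousOn
      (fun y _ => (hf y).differentiableAt.differentiableWithinAt)
      (fun y hy => by rw [(hf y).deriv]; exact hf' y (interior_subset hy))
      a self_mem_Ici x hx hx
    linarith
  have htop : Tendsto f atTop atTop := by
    refine tendsto_atTop_mono' atTop ((eventually_ge_atTop a).mono hlin) ?_
    exact tendsto_atTop_add_const_left _ _
      ((tendsto_atTop_add_const_right _ (-a) tendsto_id).const_mul_atTop hε)
  have hderiv : ∀ x, HasDerivAt (fun x => Real.exp (-f x)) (-(Real.exp (-f x) * f' x)) x :=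
    fun x => by simpa using (hf x).neg.exp
  have hint : IntegrableOn (fun x => Real.exp (-f x) * f' x) (Ioi a) := by
    refine integrable_neg_iff.1 (integrableOn_Ioi_deriv_of_nonpos' (fun x _ => hderiv x) ?_
      (Real.tendsto_exp_neg_atTop_nhds_zero.comp htop))
    intro x hx
    have := hf' x (Ioi_subset_Ici_self hx)
    exact neg_nonpos.2 (mul_nonneg (Real.exp_pos _).le (by linarith))
  refine ⟨(hint.const_mul ε⁻¹).mono' (by fun_prop) ?_, hint⟩
  filter_upwards [ae_restrict_mem measurableSet_Ioi] with x hx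
  have := hf' x (Ioi_subset_Ici_self hx)
  rw [Real.norm_of_nonneg (Real.exp_pos _).le, inv_mul_eq_div, le_div_iff₀ hε]
  gcongr

/-- If `f` has continuous derivative, at least `ε > 0` near `∞` and at most `-ε` near `-∞`, then
`exp (-f)` and its derivative are integrable. -/
theorem integrable_exp_neg_of_le_deriv {f f' : ℝ → ℝ} {a ε : ℝ} (hε : 0 < ε)
    (hf : ∀ x, HasDerivAt f (f' x) x) (hcont' : Continuous f') (hpos : ∀ x, a ≤ x → ε ≤ f' x)
    (hneg : ∀ x, x ≤ -a → f' x ≤ -ε) :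
    Integrable (fun x => Real.exp (-f x)) ∧ Integrable (fun x => Real.exp (-f x) * f' x) := by
  have hcont : Continuous f := continuous_iff_continuousAt.2 fun x => (hf x).continuousAt
  obtain ⟨hr, hr'⟩ := integrableOn_Ioi_exp_neg_of_le_deriv hε hf hpos
  obtain ⟨hl, hl'⟩ := integrableOn_Ioi_exp_neg_of_le_deriv (f := fun x => f (-x))
    (f' := fun x => -f' (-x)) (a := a) hε
    (fun x => by simpa [Function.comp_def] using (hf (-x)).comp x (hasDerivAt_neg x))
    (fun x hx => by linarith [hneg (-x) (neg_le_neg hx)])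
  have glue : ∀ g : ℝ → ℝ, Continuous g → IntegrableOn g (Ioi a) →
      IntegrableOn (fun x => g (-x)) (Ioi a) → Integrable g := by
    intro g hg hgr hgl
    have hgl' : IntegrableOn g (Iio (-a)) := by
      simpa using hgl.comp_neg
    have hmid : IntegrableOn g (Icc (-a) a) := hg.continuousOn.integrableOn_Icc
    rw [← integrableOn_univ]
    refine ((hgl'.union hmid).union hgr).mono_set fun x _ => ?_
    simp only [mem_union, mem_Iio, mem_Icc, mem_Ioi]
    grind
  refine ⟨glue _ (by fun_prop) hr hl, glue _ (by fun_prop) hr' ?_⟩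
  have hl_neg := hl'.neg
  simpa using hl_neg

/-- Fix `b > 0` and `λ ∈ ℝ`. Under Assumption 2.1 on `V`, there exists `β_c ∈ (0,1]`
such that for all `β ∈ (0, β_c)` the Gibbs measure is well defined, the function
`η ↦ β⁻¹ V'(βη)` is `ν_{β,b,λ}`-integrable, and its mean equals `λ/b`; in particular,
for `b = 1` the mean of `ξ = V_β'(η)` under `ν_{β,1,λ}` is `λ`. -/
theorem mean_of_xi
    (V : ℝ → ℝ) (γV M : ℝ) (hγV : 0 < γV) (hM : 0 < M)
    (hsmooth : ContDiff ℝ (⊤ : ℕ∞) V) (hconv : ConvexOn ℝ Set.univ V)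
    (hnonneg : ∀ x : ℝ, 0 ≤ V x) (hV0 : V 0 = 0) (hV'0 : deriv V 0 = 0)
    (hV''0 : iteratedDeriv 2 V 0 = 1)
    (hgrowth : ∀ k : ℕ, k ≤ 5 → ∀ x : ℝ, |iteratedDeriv k V x| ≤ M * Real.exp (γV * |x|))
    (b lam : ℝ) (hb : 0 < b) :
    ∃ βc ∈ Set.Ioc (0 : ℝ) 1, ∀ β ∈ Set.Ioo (0 : ℝ) βc,
      Integrable (gibbsDensity V β b lam) ∧
      Integrable (fun η : ℝ => deriv V (β * η) / β) (gibbsMeasure V β b lam) ∧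
      (∫ η : ℝ, deriv V (β * η) / β ∂(gibbsMeasure V β b lam)) = lam / b := by
  have hdiff : Differentiable ℝ V := hsmooth.differentiable (by simp)
  have hcont' : Continuous (deriv V) := hsmooth.continuous_deriv (by simp)
  have hmono : Monotone (deriv V) := by
    rw [← monotoneOn_univ]
    exact hconv.monotoneOn_deriv fun x _ => hdiff x
  have hsecond : 0 < deriv (deriv V) 0 := by
    rw [iteratedDeriv_succ, iteratedDeriv_one] at hV''0
    linarith
  obtain ⟨δ, hδ, hsign⟩ := Metric.eventually_nhds_iff.1
    (eventually_nhdsWithin_sign_eq_of_deriv_pos hsecond hV'0)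
  have hposδ : 0 < deriv V (δ / 2) := by
    have := @hsign (δ / 2) (by rw [Real.dist_0_eq_abs, abs_of_pos] <;> linarith)
    rwa [sub_zero, sign_pos (half_pos hδ), sign_eq_one_iff] at this
  have hnegδ : deriv V (-(δ / 2)) < 0 := by
    have := @hsign (-(δ / 2)) (by rw [Real.dist_0_eq_abs, abs_neg, abs_of_pos] <;> linarith)
    rwa [sub_zero, sign_neg (neg_lt_zero.2 (half_pos hδ)), sign_eq_neg_one_iff] at this
  obtain ⟨c, hc, hcpos, hcneg⟩ : ∃ c > 0, c ≤ deriv V (δ / 2) ∧ deriv V (-(δ / 2)) ≤ -c :=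
    ⟨min (deriv V (δ / 2)) (-deriv V (-(δ / 2))), lt_min hposδ (by linarith), min_le_left _ _, by
      linarith [min_le_right (deriv V (δ / 2)) (-deriv V (-(δ / 2)))]⟩
  have hlam : 0 < |lam| + 1 := by positivity
  refine ⟨min 1 (b * c / (|lam| + 1)), ⟨by positivity, min_le_left _ _⟩, ?_⟩
  rintro β ⟨hβ, hβc⟩
  have hβb : |lam| + 1 ≤ b * (c / β) := by
    have := hβc.le.trans (min_le_right _ _)
    rw [le_div_iff₀ hlam] at this
    rw [← mul_div_assoc, le_div_iff₀ hβ]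
    linarith
  have hderiv : ∀ η, HasDerivAt (fun η => b * (V (β * η) / β ^ 2) - lam * η)
      (b * (deriv V (β * η) / β) - lam) η := by
    intro η
    have h1 := (hdiff (β * η)).hasDerivAt.comp η ((hasDerivAt_id η).const_mul β)
    refine (((h1.div_const (β ^ 2)).const_mul b).sub
      ((hasDerivAt_id η).const_mul lam)).congr_deriv ?_
    field_simp
  have hdens : gibbsDensity V β b lam =
      fun η => Real.exp (-(b * (V (β * η) / β ^ 2) - lam * η)) := by
    funext η
    rw [gibbsDensity]
    ring_nf
  obtain ⟨hint, hint'⟩ := integrable_exp_neg_of_le_deriv (a := δ / 2 / β) one_pos hderiv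
    (by fun_prop)
    (fun η hη => by
      have h1 : c ≤ deriv V (β * η) := hcpos.trans (hmono (by
        rwa [div_le_iff₀' hβ] at hη))
      have h2 : b * (c / β) ≤ b * (deriv V (β * η) / β) := by gcongr
      linarith [le_abs_self lam])
    (fun η hη => by
      have h1 : deriv V (β * η) ≤ -c := (hmono (by
        rwa [← neg_div, le_div_iff₀' hβ] at hη)).trans hcneg
      have h2 : b * (deriv V (β * η) / β) ≤ b * (-c / β) := by gcongr
      have h3 : b * (-c / β) = -(b * (c / β)) := by ring
      linarith [neg_abs_le lam])
  have hzero := integral_eq_zero_of_hasDerivAt_of_integrable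
    (fun η => (hderiv η).neg.exp) (by simp only [mul_neg]; exact hint'.neg) hint
  simp only [Pi.neg_apply, mul_neg, integral_neg, neg_eq_zero] at hzero
  rw [← hdens] at hint
  simp only [← congrFun hdens] at hint' hzero
  have hprod : Integrable fun η => gibbsDensity V β b lam η * (deriv V (β * η) / β) := by
    convert (hint'.add (hint.mul_const lam)).const_mul b⁻¹ using 1
    funext η
    simp only [Pi.add_apply]
    field_simp
    ring
  have hZ : 0 < partitionZ V β b lam := by
    rw [partitionZ, hdens]
    exact integral_exp_pos (by rwa [hdens] at hint)
  have hmean : ∫ η, gibbsDensity V β b lam η * (deriv V (β * η) / β) =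
      lam / b * partitionZ V β b lam := by
    have hsplit : (fun η => gibbsDensity V β b lam η * (b * (deriv V (β * η) / β) - lam)) =
        fun η => b * (gibbsDensity V β b lam η * (deriv V (β * η) / β)) -
          lam * gibbsDensity V β b lam η := by
      funext η
      ring
    rw [hsplit, integral_sub (hprod.const_mul b) (hint.const_mul lam), integral_const_mul,
      integral_const_mul, sub_eq_zero] at hzero
    rw [partitionZ, div_mul_eq_mul_div, eq_div_iff hb.ne', mul_comm, hzero]
  have hnonneg' : ∀ η, 0 ≤ gibbsDensity V β b lam η / partitionZ V β b lam :=
    fun η => div_nonneg (Real.exp_pos _).le hZ.le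
  have hmeas : Measurable fun η =>
      ENNReal.ofReal (gibbsDensity V β b lam η / partitionZ V β b lam) := by
    have : Continuous V := hdiff.continuous
    simp only [hdens]
    fun_prop
  have hfin : ∀ᵐ η : ℝ,
      ENNReal.ofReal (gibbsDensity V β b lam η / partitionZ V β b lam) < ⊤ :=
    ae_of_all _ fun _ => ENNReal.ofReal_lt_top
  have hweight : ∀ η, (ENNReal.ofReal (gibbsDensity V β b lam η / partitionZ V β b lam)).toReal •
      (deriv V (β * η) / β) =
      gibbsDensity V β b lam η * (deriv V (β * η) / β) / partitionZ V β b lam := by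
    intro η
    rw [ENNReal.toReal_ofReal (hnonneg' η), smul_eq_mul]
    ring
  refine ⟨hint, ?_, ?_⟩
  · rw [gibbsMeasure, integrable_withDensity_iff_integrable_smul' hmeas hfin]
    simp only [hweight]
    exact hprod.div_const _
  · rw [gibbsMeasure, integral_withDensity_eq_integral_toReal_smul hmeas hfin]
    simp only [hweight]
    rw [integral_div, hmean, mul_div_cancel_right₀ _ hZ.ne']
end

section
/- Set c₃ = V'''(0) and c₄ = V''''(0). There exists a constant C > 0, depending only on V (through M and γ_V), such that for every β ∈ (0,1) and every η ∈ ℝ, |β^{−1}·V'(βη) − η − c₃·β·(β^{−2}V(βη)) − ((c₄ − c₃²)/3)·β²·(β^{−2}V(βη))·η| ≤ C·β³·exp(2γ_V·|η|); that is, writing ξ = β^{−1}V'(βη) and ζ = β^{−2}V(βη), one has ξ = η + c₃βζ + ((c₄−c₃²)/3)β²ζη + ε with |ε| ≤ Cβ³·e^{2γ_V|η|}. -/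
lemma abs_le_mul_of_abs_hasDerivAt_le {f f' : ℝ → ℝ} {A r : ℝ} (h0 : f 0 = 0)
    (hf : ∀ x, HasDerivAt f (f' x) x) (hb : ∀ x, |x| ≤ r → |f' x| ≤ A) :
    ∀ x, |x| ≤ r → |f x| ≤ A * r := by
  intro x hx
  have hr : 0 ≤ r := (abs_nonneg x).trans hx
  have hA : 0 ≤ A := (abs_nonneg _).trans (hb x hx)
  have h := (convex_Icc (-r) r).norm_image_sub_le_of_norm_hasDerivWithin_le (f := f) (f' := f')
    (C := A) (x := 0) (y := x) (fun y _ => (hf y).hasDerivWithinAt)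
    (fun y hy => hb y (abs_le.2 hy)) ⟨by linarith, hr⟩ (abs_le.1 hx)
  rw [h0, sub_zero, sub_zero, Real.norm_eq_abs, Real.norm_eq_abs] at h
  exact h.trans (mul_le_mul_of_nonneg_left hx hA)

lemma hasDerivAt_iteratedDeriv {f : ℝ → ℝ} (hf : ContDiff ℝ (⊤ : ℕ∞) f) (k : ℕ) (x : ℝ) :
    HasDerivAt (iteratedDeriv k f) (iteratedDeriv (k + 1) f x) x := by
  rw [iteratedDeriv_succ]
  exact ((hf.differentiable_iteratedDeriv k (by exact_mod_cast ENat.natCast_lt_top k)) x).hasDerivAt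

lemma pow_le_factorial_div_mul_exp {γ : ℝ} (hγ : 0 < γ) (n : ℕ) {t : ℝ} (ht : 0 ≤ t) :
    t ^ n ≤ n.factorial / γ ^ n * Real.exp (γ * t) := by
  have h := Real.pow_div_factorial_le_exp (γ * t) (by positivity) n
  rw [div_le_iff₀ (by positivity), mul_pow] at h
  rw [div_mul_eq_mul_div, le_div_iff₀ (by positivity)]
  linarith

lemma abs_deriv_sub_le_of_iteratedDeriv_bound {V : ℝ → ℝ} {γ M c₃ c₄ a : ℝ}
    (hγ : 0 < γ) (hM : 0 < M) (hV : ContDiff ℝ (⊤ : ℕ∞) V)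
    (h0 : V 0 = 0) (h1 : deriv V 0 = 0) (h2 : iteratedDeriv 2 V 0 = 1)
    (hgrowth : ∀ k : ℕ, k ≤ 5 → ∀ x : ℝ, |iteratedDeriv k V x| ≤ M * Real.exp (γ * |x|))
    (h3 : c₃ = iteratedDeriv 3 V 0) (h4 : c₄ = iteratedDeriv 4 V 0)
    (ha : a = (c₄ - c₃ ^ 2) / 3) (x : ℝ) :
    |deriv V x - x - c₃ * V x - a * (V x * x)|
      ≤ (1 + |c₃| + 4 * |a| + |a| * |x|) * (M * Real.exp (γ * |x|)) * |x| ^ 4 := by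
  set D : ℕ → ℝ → ℝ := fun k => iteratedDeriv k V with hD
  have hd : ∀ k y, HasDerivAt (D k) (D (k + 1) y) y := hasDerivAt_iteratedDeriv hV
  have e0 : D 0 = V := iteratedDeriv_zero
  have e1 : D 1 = deriv V := iteratedDeriv_one
  have z0 : D 0 0 = 0 := by rw [e0, h0]
  have z1 : D 1 0 = 0 := by rw [e1, h1]
  have z2 : D 2 0 = 1 := h2
  have z3 : D 3 0 = c₃ := h3.symm
  have z4 : D 4 0 = c₄ := h4.symm
  have b4 : ∀ y, |y| ≤ |x| → |D 5 y - c₃ * D 4 y - a * (4 * D 3 y + D 4 y * y)|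
      ≤ (1 + |c₃| + 4 * |a| + |a| * |x|) * (M * Real.exp (γ * |x|)) := by
    intro y hy
    set E := M * Real.exp (γ * |x|)
    have hE : ∀ k ≤ 5, |D k y| ≤ E := fun k hk => (hgrowth k hk y).trans
      (mul_le_mul_of_nonneg_left (Real.exp_le_exp.2 (by gcongr)) hM.le)
    have t : |D 5 y - c₃ * D 4 y - a * (4 * D 3 y + D 4 y * y)|
        ≤ |D 5 y| + |c₃| * |D 4 y| + |a| * (4 * |D 3 y| + |D 4 y| * |y|) := by
      refine (abs_sub _ _).trans ?_
      refine add_le_add ((abs_sub _ _).trans ?_) ?_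
      · rw [abs_mul]
      · rw [abs_mul]
        gcongr
        refine (abs_add_le _ _).trans ?_
        rw [abs_mul, abs_mul, abs_of_pos (by norm_num : (0 : ℝ) < 4)]
    calc _ ≤ _ := t
      _ ≤ E + |c₃| * E + |a| * (4 * E + E * |x|) := by
        gcongr <;> exact hE _ (by norm_num)
      _ = _ := by ring
  have b3 := abs_le_mul_of_abs_hasDerivAt_le
    (f := fun y => D 4 y - c₃ * D 3 y - a * (3 * D 2 y + D 3 y * y))
    (by simp only [z2, z3, z4, ha]; ring)
    (fun y => (((hd 4 y).sub ((hd 3 y).const_mul c₃)).sub ((((hd 2 y).const_mul 3).add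
      ((hd 3 y).mul (hasDerivAt_id' y))).const_mul a)).congr_deriv (by ring)) b4
  have b2 := abs_le_mul_of_abs_hasDerivAt_le
    (f := fun y => D 3 y - c₃ * D 2 y - a * (2 * D 1 y + D 2 y * y))
    (by simp only [z1, z2, z3]; ring)
    (fun y => (((hd 3 y).sub ((hd 2 y).const_mul c₃)).sub ((((hd 1 y).const_mul 2).add
      ((hd 2 y).mul (hasDerivAt_id' y))).const_mul a)).congr_deriv (by ring)) b3
  have b1 := abs_le_mul_of_abs_hasDerivAt_le
    (f := fun y => D 2 y - 1 - c₃ * D 1 y - a * (D 0 y + D 1 y * y))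
    (by simp only [z0, z1, z2]; ring)
    (fun y => ((((hd 2 y).sub_const 1).sub ((hd 1 y).const_mul c₃)).sub (((hd 0 y).add
      ((hd 1 y).mul (hasDerivAt_id' y))).const_mul a)).congr_deriv (by ring)) b2
  have b0 := abs_le_mul_of_abs_hasDerivAt_le
    (f := fun y => D 1 y - y - c₃ * D 0 y - a * (D 0 y * y))
    (by simp only [z0, z1]; ring)
    (fun y => ((((hd 1 y).sub (hasDerivAt_id' y)).sub ((hd 0 y).const_mul c₃)).sub
      (((hd 0 y).mul (hasDerivAt_id' y)).const_mul a)).congr_deriv (by ring)) b1 x le_rfl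
  simp only [e0, e1] at b0
  refine b0.trans (le_of_eq (by ring))


/-- Set `c₃ = V'''(0)` and `c₄ = V''''(0)`. Under Assumption 2.1 on `V`, there is a
constant `C > 0` depending only on `V` (through `M` and `γ_V`) such that for every
`β ∈ (0,1)` and every `η ∈ ℝ`, writing `ξ = β⁻¹ V'(βη)` and `ζ = β⁻² V(βη)`, one has
`ξ = η + c₃ β ζ + ((c₄ - c₃²)/3) β² ζ η + ε` with `|ε| ≤ C β³ e^{2 γ_V |η|}`. -/
theorem taylor_expansion_xi_third_order
    (V : ℝ → ℝ) (γV M : ℝ) (hγV : 0 < γV) (hM : 0 < M)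
    (hsmooth : ContDiff ℝ (⊤ : ℕ∞) V) (hconv : ConvexOn ℝ Set.univ V)
    (hnonneg : ∀ x : ℝ, 0 ≤ V x) (hV0 : V 0 = 0) (hV'0 : deriv V 0 = 0)
    (hV''0 : iteratedDeriv 2 V 0 = 1)
    (hgrowth : ∀ k : ℕ, k ≤ 5 → ∀ x : ℝ, |iteratedDeriv k V x| ≤ M * Real.exp (γV * |x|))
    (c₃ c₄ : ℝ) (hc₃ : c₃ = iteratedDeriv 3 V 0) (hc₄ : c₄ = iteratedDeriv 4 V 0) :
    ∃ C > (0 : ℝ), ∀ β ∈ Set.Ioo (0 : ℝ) 1, ∀ η : ℝ,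
      |deriv V (β * η) / β - η - c₃ * β * (V (β * η) / β ^ 2)
          - ((c₄ - c₃ ^ 2) / 3) * β ^ 2 * (V (β * η) / β ^ 2) * η|
        ≤ C * β ^ 3 * Real.exp (2 * γV * |η|) := by
  set a := (c₄ - c₃ ^ 2) / 3 with ha
  refine ⟨M * ((1 + |c₃| + 4 * |a|) * ((4).factorial / γV ^ 4)
    + |a| * ((5).factorial / γV ^ 5)), by positivity, ?_⟩
  rintro β ⟨hβ0, hβ1⟩ η
  have hx : |β * η| = β * |η| := by rw [abs_mul, abs_of_pos hβ0]
  have hxη : |β * η| ≤ |η| := hx ▸ mul_le_of_le_one_left (abs_nonneg _) hβ1.le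
  have hF := abs_deriv_sub_le_of_iteratedDeriv_bound hγV hM hsmooth hV0 hV'0 hV''0 hgrowth
    hc₃ hc₄ ha (β * η)
  have heq : deriv V (β * η) / β - η - c₃ * β * (V (β * η) / β ^ 2)
      - a * β ^ 2 * (V (β * η) / β ^ 2) * η
      = (deriv V (β * η) - β * η - c₃ * V (β * η) - a * (V (β * η) * (β * η))) / β := by
    field_simp
  have p4 := pow_le_factorial_div_mul_exp hγV 4 (abs_nonneg η)
  have p5 := pow_le_factorial_div_mul_exp hγV 5 (abs_nonneg η)
  have hexp : Real.exp (2 * γV * |η|) = Real.exp (γV * |η|) * Real.exp (γV * |η|) := by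
    rw [← Real.exp_add]; ring_nf
  rw [heq, abs_div, abs_of_pos hβ0, div_le_iff₀ hβ0, hexp]
  have hE : Real.exp (γV * |β * η|) ≤ Real.exp (γV * |η|) := Real.exp_le_exp.2 (by gcongr)
  set E := Real.exp (γV * |η|)
  calc _ ≤ _ := hF
    _ ≤ (1 + |c₃| + 4 * |a| + |a| * |η|) * (M * E) * (β * |η|) ^ 4 := by
      rw [← hx]; gcongr
    _ = M * β ^ 4 * E * ((1 + |c₃| + 4 * |a|) * |η| ^ 4 + |a| * |η| ^ 5) := by ring
    _ ≤ M * β ^ 4 * E * ((1 + |c₃| + 4 * |a|) * ((4).factorial / γV ^ 4 * E)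
        + |a| * ((5).factorial / γV ^ 5 * E)) := by
      gcongr
    _ = _ := by ring
end
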